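/- arXiv:1505.03345 — 2 statements merged into one kernel-verified Lean document; each statement's English description precedes it below -/
import Mathlib

section
/- For all positive integers p and n, there exist integers x₁, x₂, y₁, y₂ such that (p·x₁² + x₁·y₁ − n·y₁²) + (p·x₂² + x₂·y₂ − n·y₂²) = −p. -/
open NumberTheorySymbols

theorem jacobiSym_prod_left {ι : Type*} (s : Finset ι) (f : ι → ℤ) (b : ℕ) :
    J(∏ i ∈ s, f i | b) = ∏ i ∈ s, J(f i | b) := by
  classical
  induction s using Finset.induction_on with
  | empty => simp
  | insert a s ha ih => rw [Finset.prod_insert ha, Finset.prod_insert ha, jacobiSym.mul_left, ih]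

theorem jacobiSym_eq_one_of_mul_sq_eq {g h u v : ℤ} {ℓ : ℕ} (H : g * u ^ 2 = h * v ^ 2 + 1)
    (hd : (ℓ : ℤ) ∣ h) : J(g | ℓ) = 1 := by
  have h1 : J(g * u ^ 2 | ℓ) = 1 := by
    rw [← jacobiSym.one_left ℓ]
    apply jacobiSym.mod_left'
    rw [H, ← Int.ModEq]
    simpa using ((Int.modEq_zero_iff_dvd.2 hd).mul_right (v ^ 2)).add_right 1
  rw [jacobiSym.mul_left, jacobiSym.pow_left] at h1
  rcases jacobiSym.trichotomy u ℓ with h2 | h2 | h2 <;> simp [h2] at h1 <;> exact h1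

theorem exists_jacobiSym_eq {ℓ : ℕ} (hℓ : ℓ.Prime) (h2 : ℓ ≠ 2) {e : ℤ} (he : e = 1 ∨ e = -1) :
    ∃ x : ℕ, J(x | ℓ) = e := by
  rcases he with rfl | rfl
  · exact ⟨1, by simp⟩
  · have : Fact ℓ.Prime := ⟨hℓ⟩
    obtain ⟨a, ha⟩ := quadraticChar_exists_neg_one (F := ZMod ℓ) (by rwa [ZMod.ringChar_zmod_n])
    refine ⟨a.val, ?_⟩
    rw [← jacobiSym.legendreSym.to_jacobiSym, legendreSym]
    simpa using ha

theorem exists_jacobiSym_eq_forall {S : Finset ℕ} (hS : ∀ ℓ ∈ S, ℓ.Prime ∧ ℓ ≠ 2) {e : ℕ → ℤ}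
    (he : ∀ ℓ ∈ S, e ℓ = 1 ∨ e ℓ = -1) :
    ∃ x : ℕ, x % 4 = 1 ∧ ∀ ℓ ∈ S, J(x | ℓ) = e ℓ := by
  induction S using Finset.induction_on with
  | empty => exact ⟨1, by simp⟩
  | insert p S hp ih =>
    obtain ⟨x, hx4, hx⟩ := ih (fun ℓ h ↦ hS ℓ (Finset.mem_insert_of_mem h))
      (fun ℓ h ↦ he ℓ (Finset.mem_insert_of_mem h))
    obtain ⟨hpp, hp2⟩ := hS p (Finset.mem_insert_self _ _)
    obtain ⟨y, hy⟩ := exists_jacobiSym_eq hpp hp2 (he p (Finset.mem_insert_self _ _))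
    have hco : Nat.Coprime (4 * ∏ ℓ ∈ S, ℓ) p := by
      refine Nat.Coprime.mul_left ?_ (Nat.Coprime.prod_left fun ℓ hℓ ↦ ?_)
      · exact Nat.Coprime.pow_left 2 ((Nat.coprime_primes Nat.prime_two hpp).2 hp2.symm)
      · exact (Nat.coprime_primes (hS ℓ (Finset.mem_insert_of_mem hℓ)).1 hpp).2
          (by rintro rfl; exact hp hℓ)
    obtain ⟨z, hz1, hz2⟩ := Nat.chineseRemainder hco x y
    refine ⟨z, Eq.trans (hz1.of_mul_right _) hx4, ?_⟩
    have key : ∀ {ℓ w : ℕ}, z ≡ w [MOD ℓ] → J(z | ℓ) = J(w | ℓ) := fun h ↦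
      jacobiSym.mod_left' (Int.natCast_modEq_iff.2 h)
    intro ℓ hℓ
    rcases Finset.mem_insert.1 hℓ with rfl | hℓ
    · rw [key hz2, hy]
    · rw [key ((hz1.of_mul_left 4).of_dvd (Finset.dvd_prod_of_mem _ hℓ)), hx ℓ hℓ]

theorem exists_prime_jacobiSym_eq {S : Finset ℕ} (hS : ∀ ℓ ∈ S, ℓ.Prime ∧ ℓ ≠ 2) {e : ℕ → ℤ}
    (he : ∀ ℓ ∈ S, e ℓ = 1 ∨ e ℓ = -1) :
    ∃ q : ℕ, q.Prime ∧ q % 4 = 1 ∧ ∀ ℓ ∈ S, J(q | ℓ) = e ℓ := by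
  obtain ⟨x, hx4, hx⟩ := exists_jacobiSym_eq_forall hS he
  have hne : 4 * ∏ ℓ ∈ S, ℓ ≠ 0 :=
    mul_ne_zero (by norm_num) (Finset.prod_ne_zero_iff.2 fun ℓ h ↦ (hS ℓ h).1.ne_zero)
  have hco : x.Coprime (4 * ∏ ℓ ∈ S, ℓ) := by
    refine Nat.Coprime.mul_right ?_ (Nat.Coprime.prod_right fun ℓ hℓ ↦ ?_)
    · rw [Nat.coprime_iff_gcd_eq_one, Nat.gcd_comm, Nat.gcd_rec, hx4, Nat.gcd_one_left]
    · have : NeZero ℓ := ⟨(hS ℓ hℓ).1.ne_zero⟩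
      by_contra h
      have h0 : J(x | ℓ) = 0 := jacobiSym.eq_zero_iff_not_coprime.2 (by simpa using h)
      rcases he ℓ hℓ with h1 | h1 <;> simp [hx ℓ hℓ, h1] at h0
  obtain ⟨q, -, hq, hqx⟩ := Nat.forall_exists_prime_gt_and_modEq 0 hne hco
  refine ⟨q, hq, Eq.trans (hqx.of_mul_right _) hx4, fun ℓ hℓ ↦ ?_⟩
  rw [← hx ℓ hℓ]
  exact jacobiSym.mod_left'
    (Int.natCast_modEq_iff.2 ((hqx.of_mul_left 4).of_dvd (Finset.dvd_prod_of_mem _ hℓ)))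

theorem exists_primes_jacobiSym_eq (O : Finset ℕ) {P : Finset ℕ}
    (hP : ∀ ℓ ∈ P, ℓ.Prime ∧ ℓ ≠ 2) {e : ℕ → ℕ → ℤ}
    (he : ∀ j ∈ O, ∀ ℓ ∈ P, e j ℓ = 1 ∨ e j ℓ = -1) :
    ∃ q : ℕ → ℕ, ∀ j ∈ O, (q j).Prime ∧ q j % 4 = 1 ∧ (∀ ℓ ∈ P, J(q j | ℓ) = e j ℓ) ∧
      ∀ i ∈ O, i ≠ j → J(q i | q j) = 1 := by
  induction O using Finset.induction_on with
  | empty => exact ⟨id, by simp⟩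
  | insert k O hk ih =>
    obtain ⟨q, hq⟩ := ih fun j hj ↦ he j (Finset.mem_insert_of_mem hj)
    obtain ⟨r, hr, hr4, hrS⟩ := exists_prime_jacobiSym_eq (S := P ∪ O.image q)
      (e := fun ℓ ↦ if ℓ ∈ O.image q then 1 else e k ℓ)
      (by
        intro ℓ hℓ
        rcases Finset.mem_union.1 hℓ with h | h
        · exact hP ℓ h
        · obtain ⟨j, hj, rfl⟩ := Finset.mem_image.1 h
          exact ⟨(hq j hj).1, fun h ↦ by have := (hq j hj).2.1; omega⟩)
      (by
        intro ℓ hℓ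
        by_cases h : ℓ ∈ O.image q
        · simp only [h, if_true, true_or]
        · simp only [h, if_false]
          exact he k (Finset.mem_insert_self _ _) ℓ ((Finset.mem_union.1 hℓ).resolve_right h))
    have hPq : ∀ ℓ ∈ P, ℓ ∉ O.image q := by
      intro ℓ hℓ h
      obtain ⟨j, hj, rfl⟩ := Finset.mem_image.1 h
      have h1 := (hq j hj).2.2.1 _ hℓ
      have h0 : J(q j | q j) = 0 := by
        rw [jacobiSym.eq_zero_iff]
        simpa using ⟨(hq j hj).1.ne_zero, (hq j hj).1.ne_one⟩
      rcases he j (Finset.mem_insert_of_mem hj) _ hℓ with h2 | h2 <;> rw [h0, h2] at h1 <;>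
        norm_num at h1
    have hrq : ∀ j ∈ O, J(r | q j) = 1 := by
      intro j hj
      rw [hrS (q j) (Finset.mem_union_right _ (Finset.mem_image_of_mem _ hj)),
        if_pos (Finset.mem_image_of_mem _ hj)]
    refine ⟨Function.update q k r, fun j hj ↦ ?_⟩
    have hup : ∀ i ∈ O, Function.update q k r i = q i := fun i hi ↦
      Function.update_of_ne (by rintro rfl; exact hk hi) _ _
    rcases Finset.mem_insert.1 hj with rfl | hj'
    · rw [Function.update_self]
      refine ⟨hr, hr4, fun ℓ hℓ ↦ ?_, fun i hi hij ↦ ?_⟩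
      · rw [hrS ℓ (Finset.mem_union_left _ hℓ), if_neg (hPq ℓ hℓ)]
      · have hi := (Finset.mem_insert.1 hi).resolve_left hij
        rw [hup i hi, jacobiSym.quadratic_reciprocity_one_mod_four (hq i hi).2.1
          (Nat.odd_iff.2 (by omega)), hrq i hi]
    · rw [hup j hj']
      refine ⟨(hq j hj').1, (hq j hj').2.1, (hq j hj').2.2.1, fun i hi hij ↦ ?_⟩
      rcases Finset.mem_insert.1 hi with rfl | hi
      · rw [Function.update_self, hrq j hj']
      · rw [hup i hi]
        exact (hq j hj').2.2.2 i hi hij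

theorem exists_min_solution {N : ℕ} (hN : N % 4 = 1) (hsq : ¬ IsSquare N) :
    ∃ X y : ℕ, 0 < X ∧ X * (X + 1) = N * y ^ 2 ∧
      ∀ u v : ℕ, X + 1 = u ^ 2 → u ^ 2 ≠ N * v ^ 2 + 1 := by
  have hex : ∃ X : ℕ, 0 < X ∧ ∃ y : ℕ, X * (X + 1) = N * y ^ 2 := by
    have hsq4 : ¬ IsSquare ((4 * N : ℕ) : ℤ) := by
      rw [Int.isSquare_natCast_iff]
      rintro ⟨r, hr⟩
      have : 2 ∣ r := by
        have : 2 ∣ r * r := ⟨2 * N, by omega⟩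
        rcases Nat.prime_two.dvd_mul.1 this with h | h <;> exact h
      obtain ⟨t, rfl⟩ := this
      exact hsq ⟨t, by nlinarith⟩
    obtain ⟨x, y, hxy, hy⟩ := Pell.exists_of_not_isSquare (by push_cast; omega) hsq4
    have hxy' : x.natAbs ^ 2 = 4 * N * y.natAbs ^ 2 + 1 := by
      zify; simp only [sq_abs]; push_cast at hxy; linarith
    have hy' : 0 < y.natAbs := Int.natAbs_pos.2 hy
    generalize x.natAbs = x at hxy'
    generalize y.natAbs = y at hxy' hy'
    have hodd : x % 2 = 1 := by
      by_contra h
      obtain ⟨t, rfl⟩ : 2 ∣ x := by omega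
      have : 4 * t ^ 2 = 4 * (N * y ^ 2) + 1 := by nlinarith
      omega
    obtain ⟨X, rfl⟩ : ∃ X, x = 2 * X + 1 := ⟨x / 2, by omega⟩
    refine ⟨X, ?_, y, by nlinarith⟩
    rcases Nat.eq_zero_or_pos X with rfl | h
    · have hN0 : 0 < N := by omega
      have : 0 < N * y ^ 2 := by positivity
      nlinarith
    · exact h
  classical
  obtain ⟨hX, y, hy⟩ := Nat.find_spec hex
  refine ⟨Nat.find hex, y, hX, hy, fun u v hu huv ↦ ?_⟩
  have hmod : u % 2 = 1 ∧ v % 2 = 0 := by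
    obtain ⟨m, rfl⟩ : ∃ m, N = 4 * m + 1 := ⟨N / 4, by omega⟩
    clear hy hX hu
    obtain ⟨s, rfl | rfl⟩ := Nat.even_or_odd' u <;> obtain ⟨t, rfl | rfl⟩ := Nat.even_or_odd' v <;>
      ring_nf at huv <;> omega
  obtain ⟨t, rfl⟩ : ∃ t, u = 2 * t + 1 := ⟨u / 2, by omega⟩
  obtain ⟨w, rfl⟩ : ∃ w, v = 2 * w := ⟨v / 2, by omega⟩
  refine Nat.find_min hex (m := t) (by nlinarith) ⟨?_, w, by nlinarith⟩
  rcases Nat.eq_zero_or_pos t with rfl | h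
  · omega
  · exact h

theorem exists_sq_of_mul_succ_eq {X y g h : ℕ} (hX : 0 < X) (H : X * (X + 1) = g * h * y ^ 2)
    (hg : g.Coprime X) (hh : h.Coprime (X + 1)) :
    ∃ u v : ℕ, X + 1 = g * u ^ 2 ∧ X = h * v ^ 2 := by
  obtain ⟨m, hm⟩ : g ∣ X + 1 :=
    hg.dvd_of_dvd_mul_left (H ▸ (Dvd.intro _ (mul_assoc g h (y ^ 2)).symm))
  obtain ⟨n, hn⟩ : h ∣ X :=
    hh.dvd_of_dvd_mul_right (H ▸ (Dvd.intro (g * y ^ 2) (by ring)))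
  have hgh : 0 < g * h :=
    Nat.mul_pos (Nat.pos_of_ne_zero (by rintro rfl; simp at hm))
      (Nat.pos_of_ne_zero (by rintro rfl; simp at hn; omega))
  have hmn : m * n = y ^ 2 := by
    apply Nat.eq_of_mul_eq_mul_left hgh
    calc g * h * (m * n) = (h * n) * (g * m) := by ring
      _ = X * (X + 1) := by rw [← hm, ← hn]
      _ = _ := H
  have hco : m.Coprime n :=
    Nat.Coprime.of_dvd (Dvd.intro_left g hm.symm) (Dvd.intro_left h hn.symm)
      ((Nat.coprime_self_add_left).2 (Nat.coprime_one_left X))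
  obtain ⟨u, hu⟩ := exists_eq_pow_of_mul_eq_pow (Nat.isUnit_iff.2 hco) hmn
  obtain ⟨v, hv⟩ :=
    exists_eq_pow_of_mul_eq_pow (Nat.isUnit_iff.2 hco.symm) ((mul_comm n m).trans hmn)
  exact ⟨u, v, hu ▸ hm, hv ▸ hn⟩

theorem exists_sq_add_sq_of_forall_mod_four {n : ℕ} (h : ∀ p ∈ n.primeFactors, p % 4 ≠ 3) :
    ∃ x y : ℕ, n = x ^ 2 + y ^ 2 :=
  Nat.eq_sq_add_sq_iff.2 fun p hp h3 ↦ absurd h3 (h p hp)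

theorem exists_prod_sq_add_sq {ι : Type*} (K : Finset ι) {q : ι → ℕ}
    (hq : ∀ i ∈ K, (q i).Prime ∧ q i % 4 = 1) :
    ∃ x y : ℕ, ∏ i ∈ K, q i = x ^ 2 + y ^ 2 := by
  refine exists_sq_add_sq_of_forall_mod_four fun p hp ↦ ?_
  obtain ⟨i, hi, hpi⟩ := ((Nat.prime_of_mem_primeFactors hp).prime.dvd_finsetProd_iff _).1
    (Nat.dvd_of_mem_primeFactors hp)
  rw [(Nat.prime_dvd_prime_iff_eq (Nat.prime_of_mem_primeFactors hp) (hq i hi).1).1 hpi]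
  have := (hq i hi).2
  omega

theorem jacobiSym_prod_pow_eq_one {A : Finset ℕ} {f : ℕ → ℕ} {m : ℕ}
    (hf : ∀ ℓ ∈ A, Even (f ℓ)) (hm : ∀ ℓ ∈ A, ℓ.Coprime m) :
    J(((∏ ℓ ∈ A, ℓ ^ f ℓ : ℕ) : ℤ) | m) = 1 := by
  push_cast
  rw [jacobiSym_prod_left]
  refine Finset.prod_eq_one fun ℓ hℓ ↦ ?_
  obtain ⟨k, hk⟩ := hf ℓ hℓ
  rw [jacobiSym.pow_left, hk, ← two_mul, pow_mul, jacobiSym.sq_one (by simpa using hm ℓ hℓ),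
    one_pow]

/-- The part of `∏ ℓ ^ f ℓ` supported on a set `A` of primes. -/
def primePowProd (f : ℕ → ℕ) (A : Finset ℕ) : ℕ := ∏ ℓ ∈ A, ℓ ^ f ℓ

theorem primePowProd_mul_sdiff (f : ℕ → ℕ) {A P : Finset ℕ} (h : A ⊆ P) :
    primePowProd f A * primePowProd f (P \ A) = primePowProd f P := by
  rw [mul_comm]
  exact Finset.prod_sdiff h

/-- The primes `q j`, indexed by the set `O` of primes having odd exponent in `∏ ℓ ∈ P, ℓ ^ f ℓ`,
that serve as coefficients in the descent on Pell's equation. -/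
structure IsAuxiliary (P O : Finset ℕ) (f : ℕ → ℕ) (r : ℕ) (q : ℕ → ℕ) : Prop where
  prime : ∀ j ∈ O, (q j).Prime
  mod_four : ∀ j ∈ O, q j % 4 = 1
  symbol_primePowProd : ∀ j ∈ O, ∀ A ⊆ P, J(primePowProd f A | q j) =
    (if j ∈ A then -1 else 1) * (if r ∈ A ∧ j ≠ r then -1 else 1)
  symbol_of_mem : ∀ j ∈ O, ∀ ℓ ∈ O, J(q j | ℓ) =
    (if ℓ = j then -1 else 1) * (if ℓ = r ∧ j ≠ r then -1 else 1)
  symbol_of_notMem : ∀ j ∈ O, ∀ ℓ ∈ P, ℓ ∉ O → J(q j | ℓ) =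
    if j = r then -J(primePowProd f (P.erase ℓ) | ℓ) else if ℓ % 4 = 1 then 1 else ZMod.χ₄ j
  symbol_of_ne : ∀ j ∈ O, ∀ i ∈ O, i ≠ j → J(q i | q j) = 1

section

variable {P O : Finset ℕ} {f : ℕ → ℕ} {r : ℕ}

theorem coprime_primePowProd (hP : ∀ ℓ ∈ P, ℓ.Prime ∧ ℓ ≠ 2) {A : Finset ℕ} (hA : A ⊆ P) {ℓ : ℕ}
    (hℓ : ℓ ∈ P) (hℓA : ℓ ∉ A) : (primePowProd f A).Coprime ℓ :=
  Nat.Coprime.prod_left fun m hm ↦ Nat.Coprime.pow_left _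
    ((Nat.coprime_primes (hP m (hA hm)).1 (hP ℓ hℓ).1).2 (by rintro rfl; exact hℓA hm))

theorem exists_isAuxiliary (hP : ∀ ℓ ∈ P, ℓ.Prime ∧ ℓ ≠ 2) (hOP : O ⊆ P)
    (hO : ∀ ℓ ∈ P, ℓ ∈ O ↔ Odd (f ℓ)) (hr : r ∈ O) : ∃ q, IsAuxiliary P O f r q := by
  have hPodd : ∀ ℓ ∈ P, Odd ℓ := fun ℓ hℓ ↦ (hP ℓ hℓ).1.odd_of_ne_two (hP ℓ hℓ).2
  obtain ⟨e, he⟩ : ∃ e : ℕ → ℕ → ℤ, ∀ j ℓ, e j ℓ =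
    if ℓ ∈ O then (if ℓ = j then -1 else 1) * (if ℓ = r ∧ j ≠ r then -1 else 1)
    else if j = r then -J(primePowProd f (P.erase ℓ) | ℓ)
    else if ℓ % 4 = 1 then 1 else ZMod.χ₄ j := ⟨_, fun _ _ ↦ rfl⟩
  have hchi : ∀ ℓ ∈ P, ZMod.χ₄ ℓ = 1 ∨ ZMod.χ₄ ℓ = -1 := fun ℓ hℓ ↦
    (Nat.odd_mod_four_iff.1 (Nat.odd_iff.1 (hPodd ℓ hℓ))).imp ZMod.χ₄_nat_one_mod_four
      ZMod.χ₄_nat_three_mod_four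
  have hesign : ∀ j ∈ O, ∀ ℓ ∈ P, e j ℓ = 1 ∨ e j ℓ = -1 := by
    intro j hj ℓ hℓ
    have hcop := coprime_primePowProd (f := f) hP (P.erase_subset ℓ) hℓ (P.notMem_erase ℓ)
    have h1 := jacobiSym.eq_one_or_neg_one (a := primePowProd f (P.erase ℓ)) (b := ℓ)
      (by simpa using hcop)
    have h2 := hchi j (hOP hj)
    rw [he]
    split_ifs
    all_goals first
      | exact h2
      | norm_num
    rw [neg_eq_iff_eq_neg, or_comm]
    exact h1
  obtain ⟨q, hq⟩ := exists_primes_jacobiSym_eq O hP hesign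
  refine ⟨q, fun j hj ↦ (hq j hj).1, fun j hj ↦ (hq j hj).2.1, fun j hj A hA ↦ ?_,
    fun j hj ℓ hℓ ↦ ?_, fun j hj ℓ hℓ hℓO ↦ ?_, fun j hj ↦ (hq j hj).2.2.2⟩
  · have h1 : J(primePowProd f A | q j) = ∏ ℓ ∈ A,
        (if ℓ = j then (-1 : ℤ) else 1) * (if ℓ = r then (if j ≠ r then -1 else 1) else 1) := by
      rw [primePowProd, Nat.cast_prod, jacobiSym_prod_left]
      refine Finset.prod_congr rfl fun ℓ hℓ ↦ ?_
      have hsq := hesign j hj ℓ (hA hℓ)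
      rw [Nat.cast_pow, jacobiSym.pow_left, ← jacobiSym.quadratic_reciprocity_one_mod_four
        (hq j hj).2.1 (hPodd ℓ (hA hℓ)), (hq j hj).2.2.1 ℓ (hA hℓ)]
      by_cases hℓO : ℓ ∈ O
      · have hodd := (hO ℓ (hA hℓ)).1 hℓO
        have : e j ℓ ^ f ℓ = e j ℓ := by
          rcases hsq with h | h <;> rw [h]
          · exact one_pow _
          · exact hodd.neg_one_pow
        rw [this, he, if_pos hℓO, ite_and]
      · have hev : Even (f ℓ) := by
          rw [← Nat.not_odd_iff_even]
          exact fun h ↦ hℓO ((hO ℓ (hA hℓ)).2 h)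
        have hj' : ℓ ≠ j := by rintro rfl; exact hℓO hj
        have : e j ℓ ^ f ℓ = 1 := by
          rcases hsq with h | h <;> rw [h]
          · exact one_pow _
          · exact hev.neg_one_pow
        have hr' : ℓ ≠ r := by rintro rfl; exact hℓO hr
        rw [this, if_neg hj', if_neg hr', one_mul]
    rw [h1, Finset.prod_mul_distrib, Finset.prod_ite_eq', Finset.prod_ite_eq', ite_and]
  · rw [(hq j hj).2.2.1 ℓ (hOP hℓ), he, if_pos hℓ]
  · rw [(hq j hj).2.2.1 ℓ hℓ, he, if_neg hℓO]


theorem primePowProd_erase {A : Finset ℕ} (hA : A ⊆ P) {s : ℕ} (hs : s ∈ A) :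
    primePowProd f (P.erase s) = primePowProd f (P \ A) * primePowProd f (A.erase s) := by
  rw [← primePowProd_mul_sdiff f (Finset.erase_subset_erase s hA), mul_comm]
  congr 2
  ext x
  simp only [Finset.mem_sdiff, Finset.mem_erase]
  grind

theorem IsAuxiliary.eq_empty_or_eq {q : ℕ → ℕ} (h : IsAuxiliary P O f r q)
    (hP : ∀ ℓ ∈ P, ℓ.Prime ∧ ℓ ≠ 2) (hf : ∀ ℓ ∈ P, f ℓ ≠ 0) (hOP : O ⊆ P)
    (hO : ∀ ℓ ∈ P, ℓ ∈ O ↔ Odd (f ℓ)) (hr : r ∈ O) (hr4 : r % 4 = 3)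
    (hχ : ∏ i ∈ O, ZMod.χ₄ i = 1) {A K : Finset ℕ} (hA : A ⊆ P) (hK : K ⊆ O) {u v : ℤ}
    (H : ((primePowProd f A : ℤ) * ((∏ i ∈ K, q i : ℕ) : ℤ)) * u ^ 2 =
      ((primePowProd f (P \ A) : ℤ) * ((∏ i ∈ O \ K, q i : ℕ) : ℤ)) * v ^ 2 + 1) :
    (A = ∅ ∧ K = ∅) ∨ A = P := by
  have hPodd : ∀ ℓ ∈ P, Odd ℓ := fun ℓ hℓ ↦ (hP ℓ hℓ).1.odd_of_ne_two (hP ℓ hℓ).2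
  have hchi : ∀ ℓ ∈ P, ZMod.χ₄ ℓ = 1 ∨ ZMod.χ₄ ℓ = -1 := fun ℓ hℓ ↦
    (Nat.odd_mod_four_iff.1 (Nat.odd_iff.1 (hPodd ℓ hℓ))).imp ZMod.χ₄_nat_one_mod_four
      ZMod.χ₄_nat_three_mod_four
  have hdvd : ∀ {ℓ : ℕ} {T : Finset ℕ}, ℓ ∈ T → T ⊆ P → (ℓ : ℤ) ∣ primePowProd f T :=
    fun {ℓ T} hℓ hT ↦ Int.natCast_dvd_natCast.2
      ((dvd_pow_self ℓ (hf ℓ (hT hℓ))).trans (Finset.dvd_prod_of_mem (fun ℓ ↦ ℓ ^ f ℓ) hℓ))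
  have hdvdq : ∀ {j : ℕ} {T : Finset ℕ}, j ∈ T → (q j : ℤ) ∣ ((∏ i ∈ T, q i : ℕ) : ℤ) :=
    fun {j T} hj ↦ Int.natCast_dvd_natCast.2 (Finset.dvd_prod_of_mem q hj)
  have hone : ∀ {ℓ : ℕ}, (ℓ : ℤ) ∣
      (primePowProd f (P \ A) : ℤ) * ((∏ i ∈ O \ K, q i : ℕ) : ℤ) →
      J(primePowProd f A | ℓ) * J((∏ i ∈ K, q i : ℕ) | ℓ) = 1 := fun hℓ ↦ by
    rw [← jacobiSym.mul_left]
    exact jacobiSym_eq_one_of_mul_sq_eq H hℓ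
  have hnegone : ∀ {ℓ : ℕ}, Odd ℓ → (ℓ : ℤ) ∣
      (primePowProd f A : ℤ) * ((∏ i ∈ K, q i : ℕ) : ℤ) →
      ZMod.χ₄ ℓ * (J(primePowProd f (P \ A) | ℓ) * J((∏ i ∈ O \ K, q i : ℕ) | ℓ)) = 1 :=
    fun hodd hℓ ↦ by
    rw [← jacobiSym.mul_left, ← jacobiSym.neg _ hodd]
    refine jacobiSym_eq_one_of_mul_sq_eq (u := v) (v := u) ?_ (dvd_neg.2 hℓ)
    linarith
  have hqq : ∀ j ∈ O, ∀ T ⊆ O, j ∉ T → J((∏ i ∈ T, q i : ℕ) | q j) = 1 := fun j hj T hT hjT ↦ by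
    rw [Nat.cast_prod, jacobiSym_prod_left]
    exact Finset.prod_eq_one fun i hi ↦
      h.symbol_of_ne j hj i (hT hi) (by rintro rfl; exact hjT hi)
  have hqℓ : ∀ ℓ ∈ O, ℓ ≠ r → ∀ T ⊆ O,
      J((∏ i ∈ T, q i : ℕ) | ℓ) = if ℓ ∈ T then -1 else 1 := fun ℓ hℓ hℓr T hT ↦ by
    rw [Nat.cast_prod, jacobiSym_prod_left, ← Finset.prod_ite_eq T ℓ fun _ ↦ (-1 : ℤ)]
    exact Finset.prod_congr rfl fun i hi ↦ by
      rw [h.symbol_of_mem i (hT hi) ℓ hℓ, if_neg (c := ℓ = r ∧ i ≠ r) (by tauto), mul_one]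
  have hqs : ∀ s ∈ P, s ∉ O → ∀ T ⊆ O, r ∈ T → J((∏ i ∈ T, q i : ℕ) | s) =
      -J(primePowProd f (P.erase s) | s) *
        ∏ i ∈ T.erase r, if s % 4 = 1 then 1 else ZMod.χ₄ i := fun s hs hsO T hT hrT ↦ by
    rw [Nat.cast_prod, jacobiSym_prod_left, ← Finset.mul_prod_erase T _ hrT,
      h.symbol_of_notMem r hr s hs hsO, if_pos rfl]
    congr 1
    exact Finset.prod_congr rfl fun i hi ↦ by
      rw [h.symbol_of_notMem i (hT (Finset.mem_of_mem_erase hi)) s hs hsO,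
        if_neg (Finset.ne_of_mem_erase hi)]
  have hsquare : ∀ T ⊆ P, (∀ x ∈ T, x ∉ O) → ∀ ℓ ∈ P, ℓ ∉ T → J(primePowProd f T | ℓ) = 1 :=
    fun T hT hTO ℓ hℓ hℓT ↦ jacobiSym_prod_pow_eq_one
      (fun x hx ↦ Nat.not_odd_iff_even.1 fun h' ↦ hTO x hx ((hO x (hT hx)).2 h'))
      (fun x hx ↦ (Nat.coprime_primes (hP x (hT hx)).1 (hP ℓ hℓ).1).2
        (by rintro rfl; exact hℓT hx))
  have hnotMem : ∀ j ∈ O, j ∉ K →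
      (if j ∈ A then (-1 : ℤ) else 1) * (if r ∈ A ∧ j ≠ r then -1 else 1) = 1 := fun j hj hjK ↦ by
    rw [← h.symbol_primePowProd j hj A hA, ← mul_one J(_ | _)]
    nth_rw 1 [← hqq j hj K hK hjK]
    exact hone (dvd_mul_of_dvd_right (hdvdq (Finset.mem_sdiff.2 ⟨hj, hjK⟩)) _)
  have hmem : ∀ j ∈ O, j ∈ K →
      (if j ∈ A then (1 : ℤ) else -1) * (if r ∉ A ∧ j ≠ r then -1 else 1) = 1 := fun j hj hjK ↦ by
    have h1 := h.symbol_primePowProd j hj (P \ A) Finset.sdiff_subset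
    have h2 := hnegone (Nat.odd_iff.2 (by have := h.mod_four j hj; omega))
      (dvd_mul_of_dvd_right (hdvdq hjK) _)
    rw [ZMod.χ₄_nat_one_mod_four (h.mod_four j hj),
      hqq j hj _ Finset.sdiff_subset (fun h' ↦ (Finset.mem_sdiff.1 h').2 hjK), h1] at h2
    simpa [Finset.mem_sdiff, hOP hj, hOP hr, ite_not] using h2
  have hrAK : r ∈ A ↔ r ∈ K := by
    have h1 := hnotMem r hr
    have h2 := hmem r hr
    by_cases hrA : r ∈ A <;> by_cases hrK : r ∈ K <;> simp_all
  have hOA : ∀ j ∈ O, (j ∈ A ↔ r ∈ A) := fun j hj ↦ by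
    rcases eq_or_ne j r with rfl | hjr
    · rfl
    have h1 := hnotMem j hj
    have h2 := hmem j hj
    by_cases hjA : j ∈ A <;> by_cases hrA : r ∈ A <;> by_cases hjK : j ∈ K <;>
      simp [hjA, hrA, hjK, hjr] at h1 h2 ⊢
  have hself : ∀ (a : ℤ) (s : ℕ), J(a | s) * -J(a | s) ≠ 1 := fun a s hs ↦ by
    nlinarith [sq_nonneg J(a | s)]
  by_cases hrA : r ∈ A
  · right
    refine hA.antisymm fun s hs ↦ by_contra fun hsA ↦ ?_
    have hsB := Finset.mem_sdiff.2 ⟨hs, hsA⟩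
    have hBO : ∀ x ∈ P \ A, x ∉ O := fun x hx hxO ↦
      (Finset.mem_sdiff.1 hx).2 ((hOA x hxO).2 hrA)
    have hKχ : ∀ i ∈ K, i ≠ r → ZMod.χ₄ i = 1 := fun i hi hir ↦ by
      have hiO := hK hi
      have hiA := (hOA i hiO).2 hrA
      have h1 := hnegone (hPodd i (hA hiA)) (dvd_mul_of_dvd_left (hdvd hiA hA) _)
      rw [hsquare _ Finset.sdiff_subset hBO i (hA hiA) (fun h' ↦ (Finset.mem_sdiff.1 h').2 hiA),
        hqℓ i hiO hir _ Finset.sdiff_subset,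
        if_neg (fun h' ↦ (Finset.mem_sdiff.1 h').2 hi)] at h1
      simpa using h1
    have h1 := hone (dvd_mul_of_dvd_left (hdvd hsB Finset.sdiff_subset) _)
    have hprod : (∏ i ∈ K.erase r, if s % 4 = 1 then 1 else ZMod.χ₄ i) = 1 :=
      Finset.prod_eq_one fun i hi ↦ by
        rw [hKχ i (Finset.mem_of_mem_erase hi) (Finset.ne_of_mem_erase hi), ite_self]
    rw [hqs s hs (hBO s hsB) K hK (hrAK.1 hrA), hprod, mul_one,
      primePowProd_erase Finset.sdiff_subset hsB, Finset.sdiff_sdiff_eq_self hA, Nat.cast_mul,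
      jacobiSym.mul_left, hsquare ((P \ A).erase s)
        ((Finset.erase_subset _ _).trans Finset.sdiff_subset)
        (fun x hx ↦ hBO x (Finset.mem_of_mem_erase hx)) s hs (Finset.notMem_erase _ _),
      mul_one] at h1
    exact hself _ _ h1
  · left
    have hAO : ∀ x ∈ A, x ∉ O := fun x hx hxO ↦ hrA ((hOA x hxO).1 hx)
    have hKe : K = ∅ := Finset.eq_empty_of_forall_notMem fun i hi ↦ by
      have hiO := hK hi
      have hir : i ≠ r := by rintro rfl; exact hrA (hrAK.2 hi)
      have hiA : i ∉ A := fun h' ↦ hAO i h' hiO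
      have h1 := hone (dvd_mul_of_dvd_left
        (hdvd (Finset.mem_sdiff.2 ⟨hOP hiO, hiA⟩) Finset.sdiff_subset) _)
      rw [hsquare A hA hAO i (hOP hiO) hiA, hqℓ i hiO hir K hK, if_pos hi] at h1
      norm_num at h1
    refine ⟨Finset.eq_empty_of_forall_notMem fun s hsA ↦ ?_, hKe⟩
    have hs := hA hsA
    have h1 := hnegone (hPodd s hs) (dvd_mul_of_dvd_left (hdvd hsA hA) _)
    have hprod : (∏ i ∈ O.erase r, if s % 4 = 1 then 1 else ZMod.χ₄ i) = ZMod.χ₄ s := by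
      rcases Nat.odd_mod_four_iff.1 (Nat.odd_iff.1 (hPodd s hs)) with h4 | h4
      · rw [ZMod.χ₄_nat_one_mod_four h4]
        exact Finset.prod_eq_one fun i _ ↦ if_pos h4
      · rw [ZMod.χ₄_nat_three_mod_four h4]
        simp only [h4, show ¬ (3 = 1) by norm_num, if_false]
        rw [← Finset.mul_prod_erase O _ hr, ZMod.χ₄_nat_three_mod_four hr4] at hχ
        linarith
    rw [hKe, Finset.sdiff_empty, hqs s hs (hAO s hsA) O subset_rfl hr, hprod,
      primePowProd_erase hA hsA, Nat.cast_mul, jacobiSym.mul_left,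
      hsquare (A.erase s) ((Finset.erase_subset _ _).trans hA)
        (fun x hx ↦ hAO x (Finset.mem_of_mem_erase hx)) s hs (Finset.notMem_erase _ _),
      mul_one] at h1
    rcases hchi s hs with h2 | h2 <;> rw [h2] at h1 <;>
      exact hself (primePowProd f (P \ A)) s (by linarith)

end

theorem exists_mul_sq_add_sq_eq_of_three_mod_four {D r : ℕ} (hD : D % 4 = 1) (hr4 : r % 4 = 3)
    (hrD : Odd (D.factorization r)) :
    ∃ s t v w : ℕ, D * (s ^ 2 + t ^ 2) = v ^ 2 + w ^ 2 + 1 := by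
  classical
  have hD0 : D ≠ 0 := by omega
  obtain ⟨f, hf⟩ : ∃ f : ℕ → ℕ, ∀ ℓ, f ℓ = D.factorization ℓ := ⟨_, fun _ ↦ rfl⟩
  set P := D.primeFactors with hPdef
  obtain ⟨O, hOdef⟩ : ∃ O, O = P.filter fun ℓ ↦ Odd (f ℓ) := ⟨_, rfl⟩
  have hOP : O ⊆ P := hOdef ▸ Finset.filter_subset _ _
  have hO : ∀ ℓ ∈ P, ℓ ∈ O ↔ Odd (f ℓ) := fun ℓ hℓ ↦ by simp [hOdef, hℓ]
  have hf0 : ∀ ℓ, ℓ ∈ P ↔ f ℓ ≠ 0 := fun ℓ ↦ by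
    rw [hf, hPdef, ← Nat.support_factorization, Finsupp.mem_support_iff]
  have hP : ∀ ℓ ∈ P, ℓ.Prime ∧ ℓ ≠ 2 := fun ℓ hℓ ↦
    ⟨Nat.prime_of_mem_primeFactors hℓ, by
      rintro rfl
      have := Nat.dvd_of_mem_primeFactors hℓ
      omega⟩
  have hrO : r ∈ O := by
    have hrf : Odd (f r) := hf r ▸ hrD
    exact (hO r ((hf0 r).2 fun h ↦ by simp [h] at hrf)).2 hrf
  have hFP : primePowProd f P = D := by
    conv_rhs => rw [← Nat.prod_factorization_pow_eq_self hD0]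
    exact Finset.prod_congr rfl fun ℓ _ ↦ by rw [hf]
  have hχ : ∏ i ∈ O, ZMod.χ₄ i = 1 := by
    have h1 : ZMod.χ₄ ((primePowProd f P : ℕ) : ZMod 4) = 1 := by
      rw [hFP]
      exact ZMod.χ₄_nat_one_mod_four hD
    rw [primePowProd, Nat.cast_prod, map_prod] at h1
    rw [← h1, hOdef, Finset.prod_filter]
    refine Finset.prod_congr rfl fun ℓ hℓ ↦ ?_
    rw [Nat.cast_pow, map_pow]
    have h2 := (Nat.odd_mod_four_iff.1 (Nat.odd_iff.1
      ((hP ℓ hℓ).1.odd_of_ne_two (hP ℓ hℓ).2))).imp ZMod.χ₄_nat_one_mod_four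
      ZMod.χ₄_nat_three_mod_four
    split_ifs with h3
    · rcases h2 with h2 | h2 <;> simp [h2, h3.neg_one_pow]
    · rcases h2 with h2 | h2 <;> simp [h2, (Nat.not_odd_iff_even.1 h3).neg_one_pow]
  obtain ⟨q, hq⟩ := exists_isAuxiliary (f := f) hP hOP hO hrO
  set C := ∏ i ∈ O, q i with hC
  have hC4 : C % 4 = 1 := by
    have : C ≡ ∏ _i ∈ O, 1 [MOD 4] := Nat.ModEq.prod fun i hi ↦ hq.mod_four i hi
    simpa [Nat.ModEq] using this
  have hN4 : (D * C) % 4 = 1 := by rw [Nat.mul_mod, hD, hC4]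
  have hsq : ¬ IsSquare (D * C) := by
    rintro ⟨z, hz⟩
    have hqr := hq.prime r hrO
    have hDC : D * C = q r * (D * ∏ i ∈ O.erase r, q i) := by
      rw [hC, ← Finset.mul_prod_erase O q hrO]
      ring
    obtain ⟨w, rfl⟩ : q r ∣ z := by
      rcases hqr.dvd_mul.1 (hz ▸ hDC ▸ dvd_mul_right (q r) _ : q r ∣ z * z) with h | h <;> exact h
    have hdvd : D * ∏ i ∈ O.erase r, q i = q r * (w * w) :=
      Nat.eq_of_mul_eq_mul_left hqr.pos (by rw [← hDC, hz]; ring)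
    have h0 : J((D * ∏ i ∈ O.erase r, q i : ℕ) | q r) = 0 := by
      rw [jacobiSym.eq_zero_iff, Int.gcd_natCast_natCast, hdvd, Nat.gcd_mul_right_left]
      exact ⟨hqr.ne_zero, hqr.ne_one⟩
    rw [Nat.cast_mul, jacobiSym.mul_left, ← hFP, hq.symbol_primePowProd r hrO P subset_rfl,
      Nat.cast_prod, jacobiSym_prod_left, Finset.prod_eq_one fun i hi ↦
        hq.symbol_of_ne r hrO i (Finset.mem_of_mem_erase hi) (Finset.ne_of_mem_erase hi)] at h0
    simp [hOP hrO] at h0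
  obtain ⟨X, y, hX, hXy, hmin⟩ := exists_min_solution hN4 hsq
  set A := P.filter (· ∣ X + 1) with hAdef
  set K := O.filter (q · ∣ X + 1) with hKdef
  have hA : A ⊆ P := Finset.filter_subset _ _
  have hK : K ⊆ O := Finset.filter_subset _ _
  have hCK : (∏ i ∈ K, q i) * ∏ i ∈ O \ K, q i = C := by
    rw [mul_comm]
    exact Finset.prod_sdiff hK
  have hXX : (X + 1).Coprime X := by simp
  obtain ⟨u, v, hu, hv⟩ := exists_sq_of_mul_succ_eq (y := y)
    (g := primePowProd f A * ∏ i ∈ K, q i)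
    (h := primePowProd f (P \ A) * ∏ i ∈ O \ K, q i) hX
    (by rw [hXy, ← hFP, ← hCK, ← primePowProd_mul_sdiff f hA]; ring)
    (Nat.Coprime.mul_left
      (Nat.Coprime.prod_left fun ℓ hℓ ↦ Nat.Coprime.pow_left _
        (hXX.coprime_dvd_left (Finset.mem_filter.1 hℓ).2))
      (Nat.Coprime.prod_left fun i hi ↦ hXX.coprime_dvd_left (Finset.mem_filter.1 hi).2))
    (Nat.Coprime.mul_left
      (Nat.Coprime.prod_left fun ℓ hℓ ↦ Nat.Coprime.pow_left _ (by
        obtain ⟨h1, h2⟩ := Finset.mem_sdiff.1 hℓ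
        exact (hP ℓ h1).1.coprime_iff_not_dvd.2 fun h ↦ h2 (Finset.mem_filter.2 ⟨h1, h⟩)))
      (Nat.Coprime.prod_left fun i hi ↦ by
        obtain ⟨h1, h2⟩ := Finset.mem_sdiff.1 hi
        exact (hq.prime i h1).coprime_iff_not_dvd.2 fun h ↦ h2 (Finset.mem_filter.2 ⟨h1, h⟩)))
  have heq : (primePowProd f A * ∏ i ∈ K, q i) * u ^ 2 =
      (primePowProd f (P \ A) * ∏ i ∈ O \ K, q i) * v ^ 2 + 1 := by rw [← hu, ← hv]
  rcases hq.eq_empty_or_eq hP (fun ℓ hℓ ↦ (hf0 ℓ).1 hℓ) hOP hO hrO hr4 hχ hA hK (u := u) (v := v)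
    (by exact_mod_cast heq) with ⟨hA0, hK0⟩ | hAP
  · simp only [hA0, hK0, Finset.sdiff_empty, hFP, ← hC] at hu heq
    simp [primePowProd] at hu heq
    exact absurd heq (hmin u v hu)
  · simp only [hAP, Finset.sdiff_self, hFP] at heq
    obtain ⟨s, t, hst⟩ := exists_prod_sq_add_sq K fun i hi ↦
      ⟨hq.prime i (hK hi), hq.mod_four i (hK hi)⟩
    obtain ⟨x, z, hxz⟩ := exists_prod_sq_add_sq (O \ K) fun i hi ↦
      ⟨hq.prime i (Finset.sdiff_subset hi), hq.mod_four i (Finset.sdiff_subset hi)⟩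
    refine ⟨s * u, t * u, x * v, z * v, ?_⟩
    rw [hst, hxz] at heq
    simp [primePowProd] at heq
    linear_combination heq

theorem exists_linear_combination {a b n : ℤ} (h : IsCoprime a b) :
    ∃ s t : ℤ, a * s + b * t = n := by
  obtain ⟨s, t, hst⟩ := h
  exact ⟨s * n, t * n, by linear_combination n * hst⟩

theorem exists_prime_dvd_add_one {f : ℕ} (hf : Odd f) (B : ℕ) :
    ∃ q, q.Prime ∧ B < q ∧ q % 4 = 1 ∧ 2 * f ∣ q + 1 := by
  have hf0 := hf.pos
  have hco : Nat.Coprime 4 f := Nat.Coprime.pow_left 2 (Nat.coprime_two_left.2 hf)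
  obtain ⟨z, hz4, hzf⟩ := Nat.chineseRemainder hco 1 (f - 1)
  have hz : z.Coprime (4 * f) := by
    refine Nat.Coprime.mul_right ?_ ?_
    · rw [Nat.coprime_iff_gcd_eq_one, hz4.gcd_eq, Nat.gcd_one_left]
    · rw [Nat.coprime_iff_gcd_eq_one, hzf.gcd_eq]
      obtain ⟨k, rfl⟩ : ∃ k, f = k + 1 := ⟨f - 1, by omega⟩
      simp
  obtain ⟨q, hqB, hq, hqz⟩ := Nat.forall_exists_prime_gt_and_modEq B (by omega) hz
  have hq4 : q % 4 = 1 := Eq.trans (hqz.of_mul_right _) hz4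
  refine ⟨q, hq, hqB, hq4, ?_⟩
  refine (Nat.coprime_two_left.2 hf).mul_dvd_of_dvd_of_dvd (by omega) ?_
  have h1 : q + 1 ≡ f - 1 + 1 [MOD f] := ((hqz.of_mul_left 4).trans hzf).add_right 1
  rw [Nat.sub_add_cancel hf0] at h1
  exact (Nat.modEq_zero_iff_dvd.1 (h1.trans (by simp [Nat.ModEq])))

theorem exists_mul_sq_add_sq_eq_of_sq_add_sq {D x y : ℤ} (hD : Odd D) (hxy : D = x ^ 2 + y ^ 2) :
    ∃ s t v w : ℤ, D * (s ^ 2 + t ^ 2) = v ^ 2 + w ^ 2 + 1 := by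
  have hne : x ≠ 0 ∨ y ≠ 0 := by
    by_contra! h
    simp [hxy, h] at hD
  have hg : 0 < Int.gcd x y := Int.gcd_pos_iff.2 hne
  obtain ⟨a, b, hab, hx, hy⟩ := Int.exists_gcd_one hg
  set f := Int.gcd x y
  have hDf : D = f ^ 2 * (a ^ 2 + b ^ 2) := by rw [hxy, hx, hy]; ring
  have hfodd : Odd f := by
    rw [hDf, Int.odd_mul] at hD
    have := (Int.odd_pow' two_ne_zero).1 hD.1
    exact_mod_cast this
  obtain ⟨q, hq, hqB, hq4, m, hm⟩ := exists_prime_dvd_add_one hfodd (a ^ 2 + b ^ 2).natAbs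
  have : Fact q.Prime := ⟨hq⟩
  obtain ⟨c, d, hcd⟩ := Nat.Prime.sq_add_sq (p := q) (by omega)
  have hab' := Int.isCoprime_iff_gcd_eq_one.2 hab
  have hpos : 0 < a ^ 2 + b ^ 2 := by
    by_contra h
    have h1 : D = 0 := by
      rw [hDf, show a ^ 2 + b ^ 2 = 0 by nlinarith [sq_nonneg a, sq_nonneg b], mul_zero]
    simp [h1] at hD
  have hqab : ¬ (q : ℤ) ∣ a ^ 2 + b ^ 2 := fun h ↦ by
    have := Int.le_of_dvd hpos h
    omega
  have hco : IsCoprime (a * c + b * d : ℤ) (b * c - a * d) := by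
    have hcd' : IsCoprime (c : ℤ) d := Nat.isCoprime_iff_coprime.2 <| Nat.isUnit_iff.1 <|
      hq.squarefree _ (by
        rw [← hcd, sq, sq]
        exact dvd_add (mul_dvd_mul (Nat.gcd_dvd_left c d) (Nat.gcd_dvd_left c d))
          (mul_dvd_mul (Nat.gcd_dvd_right c d) (Nat.gcd_dvd_right c d)))
    obtain ⟨i, j, hij⟩ := hab'
    obtain ⟨k, l, hkl⟩ := hcd'
    obtain ⟨g, h, hgh⟩ := ((Nat.prime_iff_prime_int.1 hq).coprime_iff_not_dvd).2 hqab
    have hcdz : (c : ℤ) ^ 2 + d ^ 2 = q := by exact_mod_cast hcd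
    refine ⟨g * (i * c + j * d) + h * (k * a + l * b),
      g * (j * c - i * d) + h * (k * b - l * a), ?_⟩
    linear_combination hgh + g * q * hij + h * (a ^ 2 + b ^ 2) * hkl + g * (i * a + j * b) * hcdz
  -- with `w = (x + yi)(s + ti)` and `u = c + di` one has `|w|² - |w - u|² = 1`
  obtain ⟨s, t, hst⟩ := exists_linear_combination (n := (m : ℤ)) hco
  have hm' : (c : ℤ) ^ 2 + d ^ 2 + 1 = 2 * f * m := by exact_mod_cast hcd ▸ hm
  have hst' : 2 * f * ((a * c + b * d) * s + (b * c - a * d) * t) = (c : ℤ) ^ 2 + d ^ 2 + 1 := by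
    rw [hst, hm']
  refine ⟨s, t, x * s + y * t - c, y * s - x * t - d, ?_⟩
  rw [hxy, hx, hy]
  linear_combination hst'

theorem exists_mul_sq_add_sq_eq_sq_add_sq_add_one {D : ℕ} (hD : D % 4 = 1) :
    ∃ s t v w : ℤ, (D : ℤ) * (s ^ 2 + t ^ 2) = v ^ 2 + w ^ 2 + 1 := by
  by_cases h : ∃ r, r % 4 = 3 ∧ Odd (D.factorization r)
  · obtain ⟨r, hr4, hr⟩ := h
    obtain ⟨s, t, v, w, h⟩ := exists_mul_sq_add_sq_eq_of_three_mod_four hD hr4 hr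
    exact ⟨s, t, v, w, by exact_mod_cast h⟩
  · push Not at h
    obtain ⟨x, y, hxy⟩ := Nat.eq_sq_add_sq_iff.2 fun r hr hr4 ↦ by
      rw [← Nat.factorization_def D (Nat.prime_of_mem_primeFactors hr)]
      exact Nat.not_odd_iff_even.1 (h r hr4)
    exact exists_mul_sq_add_sq_eq_of_sq_add_sq (x := x) (y := y)
      (by exact_mod_cast Nat.odd_iff.2 (by omega)) (by exact_mod_cast hxy)

theorem stmt_0 (p n : ℤ) (hp : 0 < p) (hn : 0 < n) :
    ∃ x₁ x₂ y₁ y₂ : ℤ,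
      (p * x₁ ^ 2 + x₁ * y₁ - n * y₁ ^ 2) + (p * x₂ ^ 2 + x₂ * y₂ - n * y₂ ^ 2) = -p := by
  have hnp := mul_pos hn hp
  obtain ⟨s, t, v, w, h⟩ :=
    exists_mul_sq_add_sq_eq_sq_add_sq_add_one (D := (4 * (n * p) + 1).toNat) (by omega)
  rw [Int.toNat_of_nonneg (by omega)] at h
  refine ⟨v - s, w - t, 2 * p * s, 2 * p * t, ?_⟩
  linear_combination -p * h
end

section
/- Let p, n be positive integers, and let A be the 6×6 block-diagonal integer matrix with three blocks equal to [[p,1],[0,−n]]. Then there exist vectors v, w ∈ Z⁶ such that vᵀAv = 0, vᵀAw = 1, and wᵀAv = 0. -/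
open Matrix

/-- The symmetric matrix with diagonal `a, b, c` and off-diagonal entries `d, e, f` (at positions
`12`, `13`, `23`) is the Gram matrix of three vectors of `ℤ³`. -/
def IsGram (a b c d e f : ℤ) : Prop :=
  ∃ u v w : Fin 3 → ℤ, u ⬝ᵥ u = a ∧ v ⬝ᵥ v = b ∧ w ⬝ᵥ w = c ∧
    u ⬝ᵥ v = d ∧ u ⬝ᵥ w = e ∧ v ⬝ᵥ w = f

namespace IsGram

variable {a b c d e f : ℤ}

lemma swap_fst_snd (h : IsGram b a c d f e) : IsGram a b c d e f := by
  obtain ⟨u, v, w, h₁, h₂, h₃, h₄, h₅, h₆⟩ := h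
  exact ⟨v, u, w, h₂, h₁, h₃, by rw [dotProduct_comm, h₄], h₆, h₅⟩

lemma swap_snd_trd (h : IsGram a c b e d f) : IsGram a b c d e f := by
  obtain ⟨u, v, w, h₁, h₂, h₃, h₄, h₅, h₆⟩ := h
  exact ⟨u, w, v, h₁, h₃, h₂, h₅, h₄, by rw [dotProduct_comm, h₆]⟩

lemma of_shear_snd (n : ℤ) (h : IsGram a (b + 2 * n * d + n ^ 2 * a) c (d + n * a) e (f + n * e)) :
    IsGram a b c d e f := by
  obtain ⟨u, v, w, h₁, h₂, h₃, h₄, h₅, h₆⟩ := h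
  have h₄' := dotProduct_comm v u
  refine ⟨u, v - n • u, w, h₁, ?_, h₃, ?_, h₅, ?_⟩ <;>
    simp only [sub_dotProduct, dotProduct_sub, smul_dotProduct, dotProduct_smul, smul_eq_mul]
  · linear_combination h₂ - 2 * n * h₄ + n ^ 2 * h₁ - n * h₄'
  · linear_combination h₄ - n * h₁
  · linear_combination h₆ - n * h₅

lemma of_shear_trd (n k : ℤ)
    (h : IsGram a b (c + 2 * n * f + 2 * k * e + n ^ 2 * b + 2 * n * k * d + k ^ 2 * a) d
      (e + n * d + k * a) (f + n * b + k * d)) :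
    IsGram a b c d e f := by
  obtain ⟨u, v, w, h₁, h₂, h₃, h₄, h₅, h₆⟩ := h
  have h₄' := dotProduct_comm v u
  have h₅' := dotProduct_comm w u
  have h₆' := dotProduct_comm w v
  refine ⟨u, v, w - n • v - k • u, h₁, h₂, ?_, h₄, ?_, ?_⟩ <;>
    simp only [sub_dotProduct, dotProduct_sub, smul_dotProduct, dotProduct_smul, smul_eq_mul]
  · rw [h₄', h₅', h₆', h₁, h₂, h₃, h₄, h₅, h₆]; ring
  · linear_combination h₅ - n * h₄ - k * h₁
  · rw [h₄']; linear_combination h₆ - n * h₂ - k * h₄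

end IsGram

lemma Int.exists_abs_two_mul_add_mul_le (d : ℤ) {a : ℤ} (ha : 0 < a) :
    ∃ n : ℤ, -a ≤ 2 * (d + n * a) ∧ 2 * (d + n * a) ≤ a := by
  refine ⟨-((2 * d + a) / (2 * a)), ?_, ?_⟩
  · have := Int.mul_ediv_self_le (x := 2 * d + a) (k := 2 * a) (by lia)
    linarith
  · have := Int.lt_mul_ediv_self_add (x := 2 * d + a) (k := 2 * a) (by lia)
    linarith

lemma eq_one_of_three_mul_sq_le {a B : ℤ} (ha : 0 < a) (hB : 0 < B) (haB : 3 * a ^ 2 ≤ 4 * B)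
    (hBa : 3 * B ^ 2 ≤ 4 * a) : a = 1 ∧ B = 1 := by
  have ha' : a ≤ 1 := by
    by_contra! h
    obtain h' | h' := le_total a B <;> nlinarith
  have hB' : B ≤ 1 := by nlinarith
  lia

/-- A positive definite integral ternary quadratic form of determinant one is a sum of three
squares of integral linear forms. -/
theorem isGram_of_det_eq_one (a b c d e f : ℤ) (ha : 0 < a) (hB : 0 < a * b - d ^ 2)
    (hdet : a * b * c + 2 * d * e * f - a * f ^ 2 - b * e ^ 2 - c * d ^ 2 = 1) :
    IsGram a b c d e f := by
  obtain ⟨n, hn₁, hn₂⟩ := Int.exists_abs_two_mul_add_mul_le d ha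
  refine IsGram.of_shear_snd n ?_
  have hB' : 0 < a * (b + 2 * n * d + n ^ 2 * a) - (d + n * a) ^ 2 := by linarith
  have hBeq : a * (b + 2 * n * d + n ^ 2 * a) - (d + n * a) ^ 2 = a * b - d ^ 2 := by ring
  have hdet' : a * (b + 2 * n * d + n ^ 2 * a) * c + 2 * (d + n * a) * e * (f + n * e)
      - a * (f + n * e) ^ 2 - (b + 2 * n * d + n ^ 2 * a) * e ^ 2 - c * (d + n * a) ^ 2 = 1 := by
    linear_combination hdet
  generalize b + 2 * n * d + n ^ 2 * a = b₁ at *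
  generalize d + n * a = d₁ at *
  generalize f + n * e = f₁ at *
  obtain hab | hab := lt_or_ge b₁ a
  · have hb : 0 < b₁ := by nlinarith
    exact (isGram_of_det_eq_one b₁ a c d₁ f₁ e hb (by linarith)
      (by linear_combination hdet')).swap_fst_snd
  obtain ⟨l, hl₁, hl₂⟩ := Int.exists_abs_two_mul_add_mul_le (a * f₁ - d₁ * e) hB'
  obtain ⟨k, hk₁, hk₂⟩ := Int.exists_abs_two_mul_add_mul_le (e + l * d₁) ha
  refine IsGram.of_shear_trd l k ?_
  have hdet₂ : a * b₁ * (c + 2 * l * f₁ + 2 * k * e + l ^ 2 * b₁ + 2 * l * k * d₁ + k ^ 2 * a)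
      + 2 * d₁ * (e + l * d₁ + k * a) * (f₁ + l * b₁ + k * d₁)
      - a * (f₁ + l * b₁ + k * d₁) ^ 2 - b₁ * (e + l * d₁ + k * a) ^ 2
      - (c + 2 * l * f₁ + 2 * k * e + l ^ 2 * b₁ + 2 * l * k * d₁ + k ^ 2 * a) * d₁ ^ 2 = 1 := by
    linear_combination hdet'
  have hF : a * f₁ - d₁ * e + l * (a * b₁ - d₁ ^ 2)
      = a * (f₁ + l * b₁ + k * d₁) - d₁ * (e + l * d₁ + k * a) := by ring
  rw [hF] at hl₁ hl₂
  generalize c + 2 * l * f₁ + 2 * k * e + l ^ 2 * b₁ + 2 * l * k * d₁ + k ^ 2 * a = c₂ at *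
  generalize e + l * d₁ + k * a = e₂ at *
  generalize f₁ + l * b₁ + k * d₁ = f₂ at *
  have hprod : (a * b₁ - d₁ ^ 2) * (a * c₂ - e₂ ^ 2) = a + (a * f₂ - d₁ * e₂) ^ 2 := by
    linear_combination a * hdet₂
  have hC : 0 < a * c₂ - e₂ ^ 2 := by
    refine pos_of_mul_pos_right (a := a * b₁ - d₁ ^ 2) ?_ hB'.le
    rw [hprod]; positivity
  obtain hBC | hBC := lt_or_ge (a * c₂ - e₂ ^ 2) (a * b₁ - d₁ ^ 2)
  · exact (isGram_of_det_eq_one a c₂ b₁ e₂ d₁ f₂ ha hC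
      (by linear_combination hdet₂)).swap_snd_trd
  have hB₃ : 3 * (a * b₁ - d₁ ^ 2) ^ 2 ≤ 4 * a := by nlinarith
  have ha₃ : 3 * a ^ 2 ≤ 4 * (a * b₁ - d₁ ^ 2) := by nlinarith
  obtain ⟨rfl, hB_one⟩ := eq_one_of_three_mul_sq_le ha hB' ha₃ hB₃
  have hd : d₁ = 0 := by lia
  have he : e₂ = 0 := by lia
  subst hd he
  obtain rfl : b₁ = 1 := by linarith
  obtain rfl : f₂ = 0 := by lia
  obtain rfl : c₂ = 1 := by linarith
  exact ⟨![1, 0, 0], ![0, 1, 0], ![0, 0, 1], by simp [dotProduct, Fin.sum_univ_three]⟩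
termination_by (a.toNat, (a * b - d ^ 2).toNat)
decreasing_by
  · exact Prod.Lex.left _ _ (by lia)
  · exact Prod.Lex.right _ (by lia)

/-- If `N ≡ 1, 2 [MOD 4]`, there are arbitrarily large primes `q ≡ -1 [MOD N]` modulo which `-N`
is a square. -/
theorem exists_prime_gt_isSquare_neg (N : ℕ) (hN : N % 4 = 1 ∨ N % 4 = 2) (B : ℕ) :
    ∃ q : ℕ, q.Prime ∧ B < q ∧ N ∣ q + 1 ∧ IsSquare (-(N : ZMod q)) := by
  have hN0 : 0 < N := by lia
  obtain ⟨j, hj0, hj⟩ : ∃ j : ℕ, 0 < j ∧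
      (N % 4 = 1 ∧ j = 2 ∨ N % 8 = 2 ∧ j = 1 ∨ N % 8 = 6 ∧ j = 2) := by
    rcases hN with h | h
    · exact ⟨2, by lia⟩
    · obtain h | h : N % 8 = 2 ∨ N % 8 = 6 := by lia
      · exact ⟨1, by lia⟩
      · exact ⟨2, by lia⟩
  have hjN : 0 < j * N := by positivity
  have hcop : (j * N - 1).Coprime (4 * N) := by
    refine Nat.Coprime.mul_right ?_ ?_
    · have h2 : (j * N - 1).Coprime 2 := by
        rw [Nat.coprime_two_right, Nat.odd_iff]
        rcases hj with ⟨h, rfl⟩ | ⟨h, rfl⟩ | ⟨h, rfl⟩ <;> lia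
      exact h2.pow_right 2
    · refine Nat.Coprime.coprime_dvd_right (Dvd.intro_left j rfl) ?_
      exact (Nat.coprime_self_sub_left hjN).2 (Nat.coprime_one_left _)
  have : NeZero (4 * N) := ⟨by lia⟩
  obtain ⟨q, hqB, hq, hqmod⟩ := Nat.forall_exists_prime_gt_and_eq_mod
    ((ZMod.isUnit_iff_coprime _ _).2 hcop) (B + N)
  have hmod : q ≡ j * N - 1 [MOD 4 * N] := (ZMod.natCast_eq_natCast_iff _ _ _).1 hqmod
  have hdvd : N ∣ q + 1 := by
    have h := (hmod.of_dvd (Dvd.intro_left 4 rfl)).add_right 1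
    rw [Nat.sub_add_cancel hjN] at h
    exact (Nat.modEq_zero_iff_dvd.1 (h.trans (Nat.modEq_zero_iff_dvd.2 (Dvd.intro_left j rfl))))
  refine ⟨q, hq, by lia, hdvd, ?_⟩
  have : Fact q.Prime := ⟨hq⟩
  have hmod_dvd {M : ℕ} (hM : M ∣ N) : jacobiSym q M = jacobiSym (-1) M := by
    refine jacobiSym.mod_left' ?_
    refine (Int.modEq_iff_dvd.2 ?_).symm
    have : (M : ℤ) ∣ ((q + 1 : ℕ) : ℤ) := Int.natCast_dvd_natCast.2 (hM.trans hdvd)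
    simpa using this
  have hq0 : ((-(N : ℤ) : ℤ) : ZMod q) ≠ 0 := by
    rw [Int.cast_neg, neg_ne_zero, Int.cast_natCast, Ne, ZMod.natCast_eq_zero_iff]
    exact fun h => by have := Nat.le_of_dvd hN0 h; lia
  suffices jacobiSym (-(N : ℤ)) q = 1 by
    rw [← jacobiSym.legendreSym.to_jacobiSym, legendreSym.eq_one_iff _ hq0] at this
    simpa using this
  rcases hj with ⟨h, rfl⟩ | ⟨h, rfl⟩ | ⟨h, rfl⟩
  · have h4 : q % 4 = 1 := by
      have := hmod.of_dvd (Dvd.intro N rfl); simp only [Nat.ModEq] at this; lia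
    have hqo : Odd q := Nat.odd_iff.2 (by lia)
    have hNo : Odd N := Nat.odd_iff.2 (by lia)
    rw [neg_eq_neg_one_mul, jacobiSym.mul_left, jacobiSym.at_neg_one hqo,
      ZMod.χ₄_nat_one_mod_four h4, one_mul, jacobiSym.quadratic_reciprocity_one_mod_four h hqo,
      hmod_dvd dvd_rfl, jacobiSym.at_neg_one hNo, ZMod.χ₄_nat_one_mod_four h]
  all_goals
    obtain ⟨M, rfl⟩ : 2 ∣ N := by lia
    have hMo : Odd M := Nat.odd_iff.2 (by lia)
    have h8 := hmod.of_dvd (show 8 ∣ 4 * (2 * M) from ⟨M, by ring⟩)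
    simp only [Nat.ModEq] at h8
    have hqo : Odd q := Nat.odd_iff.2 (by lia)
    have hneg : (-((2 * M : ℕ) : ℤ)) = -2 * M := by push_cast; ring
    rw [hneg, jacobiSym.mul_left, jacobiSym.at_neg_two hqo, ZMod.χ₈'_nat_eq_if_mod_eight,
      if_neg (by lia), if_pos (by lia), one_mul]
  · rw [jacobiSym.quadratic_reciprocity_one_mod_four (by lia) hqo, hmod_dvd (Dvd.intro_left 2 rfl),
      jacobiSym.at_neg_one hMo, ZMod.χ₄_nat_one_mod_four (by lia)]
  · rw [jacobiSym.quadratic_reciprocity_three_mod_four (by lia) (by lia),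
      hmod_dvd (Dvd.intro_left 2 rfl), jacobiSym.at_neg_one hMo,
      ZMod.χ₄_nat_three_mod_four (by lia), neg_neg]

/-- Every `N ≡ 1, 2 [MOD 4]` is the determinant of the Gram matrix of the first two vectors of a
basis of `ℤ³`, whose dual vectors are `x` and `y`; the first has norm a large prime `q`. -/
theorem exists_vectors_of_mod_four (N : ℕ) (hN : N % 4 = 1 ∨ N % 4 = 2) (B : ℕ) :
    ∃ (q : ℕ) (b c : ℤ) (u v x y : Fin 3 → ℤ), q.Prime ∧ B < q ∧ q * c - b ^ 2 = N ∧
      u ⬝ᵥ u = q ∧ u ⬝ᵥ v = b ∧ v ⬝ᵥ v = c ∧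
      u ⬝ᵥ x = 1 ∧ v ⬝ᵥ x = 0 ∧ u ⬝ᵥ y = 0 ∧ v ⬝ᵥ y = 1 := by
  obtain ⟨q, hq, hqB, ⟨t, ht⟩, r, hr⟩ := exists_prime_gt_isSquare_neg N hN B
  obtain ⟨b, rfl⟩ := ZMod.intCast_surjective r
  obtain ⟨c, hc⟩ : (q : ℤ) ∣ b ^ 2 + N := by
    rw [← ZMod.intCast_zmod_eq_zero_iff_dvd]
    push_cast
    linear_combination -hr
  have ht' : (q : ℤ) + 1 = N * t := by exact_mod_cast ht
  have hN0 : (0 : ℤ) < N := by lia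
  obtain ⟨u, v, w, h₁, h₂, -, h₄, h₅, h₆⟩ := isGram_of_det_eq_one q c t b 0 1
    (by exact_mod_cast hq.pos) (by linarith) (by linear_combination (-t) * hc - ht')
  have h₄' := dotProduct_comm v u
  refine ⟨q, b, c, u, v, (c * t - 1) • u - (b * t) • v + b • w,
    (-(b * t)) • u + (q * t : ℤ) • v - (q : ℤ) • w, hq, hqB,
    by linarith, h₁, h₄, h₂, ?_, ?_, ?_, ?_⟩ <;>
    simp only [dotProduct_add, dotProduct_sub, dotProduct_smul, smul_eq_mul, h₁, h₂, h₄', h₄,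
      h₅, h₆]
  · linear_combination (-t) * hc - ht'
  · ring
  · ring
  · linear_combination (-t) * hc - ht'

/-- A primitive isotropic vector `x + y ω` of the Hermitian lattice `⟨1, 1, 1⟩` over `ℤ[ω]`,
`ω ^ 2 = ω + m`, together with a vector `s + t ω` having Hermitian product one with it. -/
theorem exists_isotropic_pair (m : ℕ) (hm : 0 < m) :
    ∃ x y s t : Fin 3 → ℤ, x ⬝ᵥ x + x ⬝ᵥ y - m * y ⬝ᵥ y = 0 ∧
      x ⬝ᵥ s + y ⬝ᵥ s - m * y ⬝ᵥ t = 1 ∧ x ⬝ᵥ t - y ⬝ᵥ s = 0 := by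
  obtain ⟨N, k, hk, hmN, hN⟩ : ∃ N k : ℕ, k ≤ 1 ∧ m = N + 2 * k ∧ (N % 4 = 1 ∨ N % 4 = 2) := by
    obtain h | h : (m % 4 = 1 ∨ m % 4 = 2) ∨ (m % 4 = 3 ∨ m % 4 = 0) := by lia
    · exact ⟨m, 0, by lia⟩
    · exact ⟨m - 2, 1, by lia⟩
  obtain ⟨q, b, c, u, v, x, y, hq, hqB, hN', huu, huv, hvv, hux, hvx, huy, hvy⟩ :=
    exists_vectors_of_mod_four N hN (4 * m + 1)
  have hkk : (k : ℤ) * (k + 1) = 2 * k := by interval_cases k <;> rfl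
  have hmN' : (m : ℤ) = N + k * (k + 1) := by rw [hkk]; exact_mod_cast hmN
  have hqZ : Prime (q : ℤ) := Nat.prime_iff_prime_int.1 hq
  have hnd (n : ℕ) (hn0 : 0 < n) (hn : n < q) : ¬ (q : ℤ) ∣ n := fun h =>
    absurd (Nat.le_of_dvd hn0 (Int.natCast_dvd_natCast.1 h)) (by lia)
  have hcop : IsCoprime ((k - b) ^ 2 + (k - b) - m) (q : ℤ) := by
    refine ((Prime.coprime_iff_not_dvd hqZ).2 fun h => ?_).symm
    have h' : (q : ℤ) ∣ b * (2 * b - (2 * k + 1)) := by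
      obtain ⟨r, hr⟩ := h
      exact ⟨r + c, by linear_combination hr - hN' + hmN'⟩
    obtain ⟨r, hr⟩ | ⟨r, hr⟩ := hqZ.dvd_or_dvd h'
    · exact hnd N (by lia) (by lia) ⟨c - b * r, by linear_combination -hN' - b * hr⟩
    · refine hnd (4 * m + 1) (by lia) (by lia) ⟨4 * c - r * (2 * b + (2 * k + 1)), ?_⟩
      push_cast
      linear_combination 4 * hmN' - 4 * hN' - (2 * b + (2 * k + 1)) * hr
  obtain ⟨α, β, hαβ⟩ := hcop
  have hvu := dotProduct_comm v u
  refine ⟨(k - b) • u + (q : ℤ) • v, u, (α * (k - b)) • x + β • y, α • x, ?_, ?_, ?_⟩ <;>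
    simp only [dotProduct_add, add_dotProduct, smul_dotProduct, dotProduct_smul, smul_eq_mul,
      huu, hvu, huv, hvv, hux, hvx, huy, hvy]
  · linear_combination q * hN' - q * hmN'
  · linear_combination hαβ
  · ring

theorem stmt_14 (p n : ℤ) (hp : 0 < p) (hn : 0 < n)
    (A : Matrix (Fin 6) (Fin 6) ℤ)
    (hA : A = !![p, 1, 0, 0, 0, 0;
                 0, -n, 0, 0, 0, 0;
                 0, 0, p, 1, 0, 0;
                 0, 0, 0, -n, 0, 0;
                 0, 0, 0, 0, p, 1;
                 0, 0, 0, 0, 0, -n]) :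
    ∃ v w : Fin 6 → ℤ,
      v ⬝ᵥ A.mulVec v = 0 ∧ v ⬝ᵥ A.mulVec w = 1 ∧ w ⬝ᵥ A.mulVec v = 0 := by
  have hpn : 0 < p * n := mul_pos hp hn
  obtain ⟨x, y, s, t, h₁, h₂, h₃⟩ := exists_isotropic_pair (p * n).toNat (by lia)
  rw [Int.toNat_of_nonneg hpn.le] at h₁ h₂
  simp only [dotProduct, Fin.sum_univ_three] at h₁ h₂ h₃
  refine ⟨![x 0, p * y 0, x 1, p * y 1, x 2, p * y 2],
    ![n * t 0, s 0 + t 0, n * t 1, s 1 + t 1, n * t 2, s 2 + t 2], ?_, ?_, ?_⟩ <;>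
    simp [hA, dotProduct, mulVec, Fin.sum_univ_six]
  · linear_combination p * h₁
  · linear_combination h₂ + (p * n + 1) * h₃
  · linear_combination p * n * h₃
end
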